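/- Assume every row A_{i,:} of A and every column B_{:,j} of B is nonzero, let σ_A > 0 satisfy ‖A (Aᵀ u)‖₂ ≥ σ_A ‖Aᵀ u‖₂ for every u ∈ ℝ^m and σ_B > 0 satisfy ‖Bᵀ (B v)‖₂ ≥ σ_B ‖B v‖₂ for every v ∈ ℝ^n. Let X₀ ∈ ℝ^{p×q} satisfy X₀ − X* = Aᵀ W Bᵀ for some W ∈ ℝ^{m×n}. For a finite sequence s = ((i₁,j₁),…,(i_k,j_k)) of index pairs in {1,…,m}×{1,…,n}, define recursively X_t^s = X_{t−1}^s + (A_{i_t,:})ᵀ (C_{i_t j_t} − A_{i_t,:} X_{t−1}^s B_{:,j_t}) (B_{:,j_t})ᵀ / (‖A_{i_t,:}‖₂² ‖B_{:,j_t}‖₂²) for t = 1,…,k, with X₀^s = X₀. Then for every k ≥ 0, the expectation of the squared error of the k-th GRK iterate satisfies ∑_{s ∈ ({1,…,m}×{1,…,n})^k} (∏_{t=1}^k ‖A_{i_t,:}‖₂² ‖B_{:,j_t}‖₂² / (‖A‖_F² ‖B‖_F²)) ‖X_k^s − X*‖_F² ≤ (1 − σ_A² σ_B² / (‖A‖_F²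 ‖B‖_F²))^k ‖X₀ − X*‖_F². -/

import Mathlib

open Matrix

noncomputable def vecNormSq {α : Type*} [Fintype α] (x : α → ℝ) : ℝ := ∑ i, (x i) ^ 2

noncomputable def vecNorm {α : Type*} [Fintype α] (x : α → ℝ) : ℝ := Real.sqrt (vecNormSq x)

noncomputable def frobNormSq {α β : Type*} [Fintype α] [Fintype β] (M : Matrix α β ℝ) : ℝ :=
  ∑ i, ∑ j, (M i j) ^ 2

noncomputable def frobNorm {α β : Type*} [Fintype α] [Fintype β] (M : Matrix α β ℝ) : ℝ :=
  Real.sqrt (frobNormSq M)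

noncomputable def frobInner {α β : Type*} [Fintype α] [Fintype β] (U V : Matrix α β ℝ) : ℝ :=
  ∑ i, ∑ j, U i j * V i j

def IsMPInv {α β : Type*} [Fintype α] [Fintype β] (M : Matrix α β ℝ) (P : Matrix β α ℝ) : Prop :=
  M * P * M = M ∧ P * M * P = P ∧ (M * P)ᵀ = M * P ∧ (P * M)ᵀ = P * M

def rowSub {m p : ℕ} (A : Matrix (Fin m) (Fin p) ℝ) (I : Finset (Fin m)) :
    Matrix {i // i ∈ I} (Fin p) ℝ := A.submatrix Subtype.val id

def colSub {q n : ℕ} (B : Matrix (Fin q) (Fin n) ℝ) (J : Finset (Fin n)) :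
    Matrix (Fin q) {j // j ∈ J} ℝ := B.submatrix id Subtype.val

def subMat {m n : ℕ} (C : Matrix (Fin m) (Fin n) ℝ) (I : Finset (Fin m)) (J : Finset (Fin n)) :
    Matrix {i // i ∈ I} {j // j ∈ J} ℝ := C.submatrix Subtype.val Subtype.val

noncomputable def bilin {m p q n : ℕ} (A : Matrix (Fin m) (Fin p) ℝ) (B : Matrix (Fin q) (Fin n) ℝ)
    (X : Matrix (Fin p) (Fin q) ℝ) (i : Fin m) (j : Fin n) : ℝ :=
  ∑ a, ∑ b, A i a * X a b * B b j

def rank1 {m p q n : ℕ} (A : Matrix (Fin m) (Fin p) ℝ) (B : Matrix (Fin q) (Fin n) ℝ)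
    (i : Fin m) (j : Fin n) (s : ℝ) : Matrix (Fin p) (Fin q) ℝ :=
  Matrix.of fun a b => A i a * s * B b j

noncomputable def rowSubNorm {m p : ℕ} (A : Matrix (Fin m) (Fin p) ℝ) (I : Finset (Fin m)) :
    Matrix {i // i ∈ I} (Fin p) ℝ := Matrix.of fun i a => A i.val a / vecNorm (A i.val)

noncomputable def colSubNorm {q n : ℕ} (B : Matrix (Fin q) (Fin n) ℝ) (J : Finset (Fin n)) :
    Matrix (Fin q) {j // j ∈ J} ℝ :=
  Matrix.of fun b j => B b j.val / vecNorm (fun b' => B b' j.val)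

/-- The GRK update for the index pair `ij`. -/
noncomputable def grkStep {m p q n : ℕ} (A : Matrix (Fin m) (Fin p) ℝ)
    (B : Matrix (Fin q) (Fin n) ℝ) (C : Matrix (Fin m) (Fin n) ℝ)
    (ij : Fin m × Fin n) (X : Matrix (Fin p) (Fin q) ℝ) : Matrix (Fin p) (Fin q) ℝ :=
  X + (1 / (vecNormSq (A ij.1) * vecNormSq (fun b => B b ij.2))) •
    rank1 A B ij.1 ij.2 (C ij.1 ij.2 - bilin A B X ij.1 ij.2)

lemma vecNormSq_nonneg' {α : Type*} [Fintype α] (x : α → ℝ) : 0 ≤ vecNormSq x :=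
  Finset.sum_nonneg fun _ _ => sq_nonneg _

lemma vecNormSq_pos' {α : Type*} [Fintype α] (x : α → ℝ) (hx : x ≠ 0) : 0 < vecNormSq x := by
  obtain ⟨i, hi⟩ := Function.ne_iff.mp hx
  exact Finset.sum_pos' (fun _ _ => sq_nonneg _) ⟨i, Finset.mem_univ _, by
    have : x i ≠ 0 := hi
    positivity⟩

lemma frobNormSq_nonneg' {α β : Type*} [Fintype α] [Fintype β] (M : Matrix α β ℝ) :
    0 ≤ frobNormSq M :=
  Finset.sum_nonneg fun _ _ => Finset.sum_nonneg fun _ _ => sq_nonneg _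

lemma frobNormSq_transpose' {α β : Type*} [Fintype α] [Fintype β] (M : Matrix α β ℝ) :
    frobNormSq Mᵀ = frobNormSq M := by
  unfold frobNormSq
  rw [Finset.sum_comm]
  rfl

lemma frob_lower {m p r : ℕ} (M : Matrix (Fin m) (Fin p) ℝ) (σ : ℝ) (hσ : 0 < σ)
    (h : ∀ u : Fin m → ℝ, σ * vecNorm (Mᵀ.mulVec u) ≤ vecNorm (M.mulVec (Mᵀ.mulVec u)))
    (V : Matrix (Fin m) (Fin r) ℝ) :
    σ ^ 2 * frobNormSq (Mᵀ * V) ≤ frobNormSq (M * (Mᵀ * V)) := by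
  rw [← frobNormSq_transpose' (Mᵀ * V), ← frobNormSq_transpose' (M * (Mᵀ * V))]
  unfold frobNormSq
  rw [Finset.mul_sum]
  refine Finset.sum_le_sum fun j _ => ?_
  have h1 := h (fun i => V i j)
  have h2 : (σ * vecNorm (Mᵀ.mulVec (fun i => V i j))) ^ 2
      ≤ vecNorm (M.mulVec (Mᵀ.mulVec (fun i => V i j))) ^ 2 :=
    pow_le_pow_left₀ (mul_nonneg hσ.le (Real.sqrt_nonneg _)) h1 2
  rw [mul_pow] at h2
  unfold vecNorm at h2
  rw [Real.sq_sqrt (vecNormSq_nonneg' _), Real.sq_sqrt (vecNormSq_nonneg' _)] at h2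
  exact h2

lemma bilin_eq {m p q n : ℕ} (A : Matrix (Fin m) (Fin p) ℝ) (B : Matrix (Fin q) (Fin n) ℝ)
    (X : Matrix (Fin p) (Fin q) ℝ) (i : Fin m) (j : Fin n) :
    bilin A B X i j = (A * X * B) i j := by
  simp only [bilin, Matrix.mul_apply, Finset.sum_mul]
  rw [Finset.sum_comm]

lemma step_err {m p q n : ℕ} (A : Matrix (Fin m) (Fin p) ℝ) (B : Matrix (Fin q) (Fin n) ℝ)
    (Xs X : Matrix (Fin p) (Fin q) ℝ) (ij : Fin m × Fin n) :
    grkStep A B (A * Xs * B) ij X - Xs = (X - Xs) -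
      ((A * (X - Xs) * B) ij.1 ij.2 / (vecNormSq (A ij.1) * vecNormSq (fun b => B b ij.2))) •
        rank1 A B ij.1 ij.2 1 := by
  have : (A * (X - Xs) * B) ij.1 ij.2 = (A * X * B) ij.1 ij.2 - (A * Xs * B) ij.1 ij.2 := by
    rw [Matrix.mul_sub, Matrix.sub_mul]; rfl
  ext a b
  simp only [grkStep, bilin_eq, this, rank1, Matrix.sub_apply, Matrix.add_apply,
    Matrix.smul_apply, Matrix.of_apply, smul_eq_mul]
  ring

lemma rank1_eq {m p q n : ℕ} (A : Matrix (Fin m) (Fin p) ℝ) (B : Matrix (Fin q) (Fin n) ℝ)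
    (i : Fin m) (j : Fin n) :
    rank1 A B i j 1 = Aᵀ * Matrix.single i j (1 : ℝ) * Bᵀ := by
  ext a b
  simp [rank1, Matrix.mul_apply, Matrix.single_apply, ite_and, Finset.sum_ite_eq]

lemma frob_sub_rank1 {m p q n : ℕ} (A : Matrix (Fin m) (Fin p) ℝ) (B : Matrix (Fin q) (Fin n) ℝ)
    (E : Matrix (Fin p) (Fin q) ℝ) (i : Fin m) (j : Fin n) (c : ℝ) :
    frobNormSq (E - c • rank1 A B i j 1) = frobNormSq E - 2 * c * (A * E * B) i j
      + c ^ 2 * (vecNormSq (A i) * vecNormSq (fun b => B b j)) := by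
  rw [← bilin_eq]
  have hv : vecNormSq (A i) * vecNormSq (fun b => B b j)
      = ∑ a, ∑ b, (A i a) ^ 2 * (B b j) ^ 2 := Finset.sum_mul_sum _ _ _ _
  rw [hv]
  simp only [frobNormSq, bilin, Finset.mul_sum]
  simp only [← Finset.sum_sub_distrib]
  simp only [← Finset.sum_add_distrib]
  refine Finset.sum_congr rfl fun a _ => Finset.sum_congr rfl fun b _ => ?_
  simp only [rank1, Matrix.sub_apply, Matrix.smul_apply, Matrix.of_apply, smul_eq_mul]
  ring

lemma frob_mul_frob {m p q n : ℕ} (A : Matrix (Fin m) (Fin p) ℝ) (B : Matrix (Fin q) (Fin n) ℝ) :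
    ∑ ij : Fin m × Fin n, vecNormSq (A ij.1) * vecNormSq (fun b => B b ij.2)
      = frobNormSq A * frobNormSq B := by
  rw [← frobNormSq_transpose' B, Fintype.sum_prod_type]
  exact (Finset.sum_mul_sum Finset.univ Finset.univ (fun i => vecNormSq (A i))
    (fun j => vecNormSq (fun b => B b j))).symm

lemma one_step {m p q n : ℕ}
    (A : Matrix (Fin m) (Fin p) ℝ) (B : Matrix (Fin q) (Fin n) ℝ)
    (Xs : Matrix (Fin p) (Fin q) ℝ)
    (hAnz : ∀ i, A i ≠ 0) (hBnz : ∀ j, (fun b => B b j) ≠ 0)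
    (σA σB : ℝ) (hσA : 0 < σA) (hσB : 0 < σB)
    (hA : ∀ u : Fin m → ℝ, σA * vecNorm (Aᵀ.mulVec u) ≤ vecNorm (A.mulVec (Aᵀ.mulVec u)))
    (hB : ∀ v : Fin n → ℝ, σB * vecNorm (B.mulVec v) ≤ vecNorm (Bᵀ.mulVec (B.mulVec v)))
    (i₀ : Fin m) (j₀ : Fin n)
    (X0 : Matrix (Fin p) (Fin q) ℝ) (W : Matrix (Fin m) (Fin n) ℝ)
    (hX0 : X0 - Xs = Aᵀ * W * Bᵀ) :
    ∑ ij : Fin m × Fin n, (vecNormSq (A ij.1) * vecNormSq (fun b => B b ij.2) /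
              (frobNormSq A * frobNormSq B)) * frobNormSq (grkStep A B (A * Xs * B) ij X0 - Xs)
      ≤ (1 - σA ^ 2 * σB ^ 2 / (frobNormSq A * frobNormSq B)) * frobNormSq (X0 - Xs) := by
  have hpos : ∀ ij : Fin m × Fin n, 0 < vecNormSq (A ij.1) * vecNormSq (fun b => B b ij.2) :=
    fun ij => mul_pos (vecNormSq_pos' _ (hAnz _)) (vecNormSq_pos' _ (hBnz _))
  have hF : 0 < frobNormSq A * frobNormSq B := by
    rw [← frob_mul_frob]
    exact Finset.sum_pos (fun ij _ => hpos ij) ⟨(i₀, j₀), Finset.mem_univ _⟩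
  set F := frobNormSq A * frobNormSq B with hFdef
  set E := X0 - Xs with hE
  have hterm : ∀ ij : Fin m × Fin n,
      (vecNormSq (A ij.1) * vecNormSq (fun b => B b ij.2) / F) *
        frobNormSq (grkStep A B (A * Xs * B) ij X0 - Xs)
      = (vecNormSq (A ij.1) * vecNormSq (fun b => B b ij.2)) * (frobNormSq E / F)
        - ((A * E * B) ij.1 ij.2) ^ 2 / F := by
    intro ij
    rw [step_err, frob_sub_rank1]
    have := (hpos ij).ne'
    rw [← hE]
    generalize vecNormSq (A ij.1) * vecNormSq (fun b => B b ij.2) = c at *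
    field_simp
    ring
  rw [Finset.sum_congr rfl fun ij _ => hterm ij, Finset.sum_sub_distrib, ← Finset.sum_mul,
    frob_mul_frob, ← Finset.sum_div, ← hFdef]
  have hsum : ∑ ij : Fin m × Fin n, ((A * E * B) ij.1 ij.2) ^ 2 = frobNormSq (A * E * B) := by
    rw [Fintype.sum_prod_type]; rfl
  rw [hsum]
  have h1 := frob_lower A σA hσA hA (W * Bᵀ * B)
  have h2 := frob_lower Bᵀ σB hσB (by simpa using hB) (Wᵀ * A)
  rw [← frobNormSq_transpose' (Bᵀᵀ * _), ← frobNormSq_transpose' (Bᵀ * _)] at h2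
  simp only [Matrix.transpose_mul, Matrix.transpose_transpose] at h2
  have e1 : A * (Aᵀ * (W * Bᵀ * B)) = A * E * B := by
    rw [hX0]; simp only [Matrix.mul_assoc]
  have e2 : Aᵀ * W * Bᵀ * B = Aᵀ * (W * Bᵀ * B) := by simp only [Matrix.mul_assoc]
  rw [e1] at h1
  rw [e2, ← hX0] at h2
  have h3 : σA ^ 2 * σB ^ 2 * frobNormSq E ≤ frobNormSq (A * E * B) := by
    have := mul_le_mul_of_nonneg_left h2 (sq_nonneg σA)
    linarith
  have h4 := div_le_div_of_nonneg_right h3 hF.le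
  have h5 : F * (frobNormSq E / F) = frobNormSq E := by field_simp
  rw [h5]
  have h6 : (1 - σA ^ 2 * σB ^ 2 / F) * frobNormSq E
    = frobNormSq E - σA ^ 2 * σB ^ 2 * frobNormSq E / F := by ring
  rw [h6]
  linarith

/-- linear convergence in expectation of the GRK method: the expectation of
the squared error of the `k`-th iterate (a sum over all index sequences of length `k`
weighted by the product of the sampling probabilities) decays at a linear rate. -/
theorem grk_linear_convergence {m p q n : ℕ}
    (A : Matrix (Fin m) (Fin p) ℝ) (B : Matrix (Fin q) (Fin n) ℝ)
    (Xs : Matrix (Fin p) (Fin q) ℝ) (C : Matrix (Fin m) (Fin n) ℝ) (hC : C = A * Xs * B)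
    (hAnz : ∀ i, A i ≠ 0) (hBnz : ∀ j, (fun b => B b j) ≠ 0)
    (σA σB : ℝ) (hσA : 0 < σA) (hσB : 0 < σB)
    (hA : ∀ u : Fin m → ℝ, σA * vecNorm (Aᵀ.mulVec u) ≤ vecNorm (A.mulVec (Aᵀ.mulVec u)))
    (hB : ∀ v : Fin n → ℝ, σB * vecNorm (B.mulVec v) ≤ vecNorm (Bᵀ.mulVec (B.mulVec v)))
    (X0 : Matrix (Fin p) (Fin q) ℝ) (W : Matrix (Fin m) (Fin n) ℝ)
    (hX0 : X0 - Xs = Aᵀ * W * Bᵀ) :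
    ∀ k : ℕ,
      ∑ s : Fin k → Fin m × Fin n,
          (∏ t, (vecNormSq (A (s t).1) * vecNormSq (fun b => B b (s t).2) /
              (frobNormSq A * frobNormSq B))) *
            frobNormSq ((List.ofFn s).foldl (fun X ij => grkStep A B C ij X) X0 - Xs)
        ≤ (1 - σA ^ 2 * σB ^ 2 / (frobNormSq A * frobNormSq B)) ^ k *
            frobNormSq (X0 - Xs) := by
  subst hC
  by_cases hne : Nonempty (Fin m × Fin n)
  swap
  · have hz : frobNormSq (X0 - Xs) = 0 := by
      have hW : W = 0 := by
        ext i j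
        exact (hne ⟨(i, j)⟩).elim
      rw [hX0, hW]
      simp [frobNormSq]
    intro k
    rw [hz, mul_zero]
    cases k with
    | zero => simp [hz]
    | succ k =>
      refine (Finset.sum_eq_zero fun s _ => ?_).le
      exact (hne ⟨s 0⟩).elim
  obtain ⟨i₀, j₀⟩ := hne.some
  have hstep := one_step A B Xs hAnz hBnz σA σB hσA hσB hA hB i₀ j₀
  have hw : ∀ ij : Fin m × Fin n, 0 ≤ vecNormSq (A ij.1) * vecNormSq (fun b => B b ij.2) /
      (frobNormSq A * frobNormSq B) := fun ij =>
    div_nonneg (mul_nonneg (vecNormSq_nonneg' _) (vecNormSq_nonneg' _))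
      (mul_nonneg (frobNormSq_nonneg' _) (frobNormSq_nonneg' _))
  have hρ : 0 ≤ 1 - σA ^ 2 * σB ^ 2 / (frobNormSq A * frobNormSq B) := by
    have h := hstep (Xs + rank1 A B i₀ j₀ 1) (Matrix.single i₀ j₀ 1)
      (by rw [add_sub_cancel_left, rank1_eq])
    have h0 := (Finset.sum_nonneg fun ij _ =>
      mul_nonneg (hw ij) (frobNormSq_nonneg' _)).trans h
    refine nonneg_of_mul_nonneg_left h0 ?_
    rw [add_sub_cancel_left]
    have hr : frobNormSq (rank1 A B i₀ j₀ 1)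
        = vecNormSq (A i₀) * vecNormSq (fun b => B b j₀) := by
      simp only [frobNormSq, vecNormSq, rank1, Finset.sum_mul_sum, Matrix.of_apply, mul_one,
        mul_pow]
    rw [hr]
    exact mul_pos (vecNormSq_pos' _ (hAnz _)) (vecNormSq_pos' _ (hBnz _))
  intro k
  induction k generalizing X0 W with
  | zero => simp
  | succ k ih =>
    rw [← (Fin.consEquiv (fun _ : Fin (k + 1) => Fin m × Fin n)).sum_comp,
      Fintype.sum_prod_type]
    simp only [Fin.consEquiv_apply, Fin.prod_univ_succ, List.ofFn_succ, Fin.cons_zero,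
      Fin.cons_succ, List.foldl_cons, mul_assoc, ← Finset.mul_sum]
    rw [pow_succ, mul_assoc]
    refine le_trans ?_ (mul_le_mul_of_nonneg_left (hstep X0 W hX0) (pow_nonneg hρ k))
    rw [Finset.mul_sum]
    refine Finset.sum_le_sum fun ij _ => ?_
    rw [mul_left_comm]
    refine mul_le_mul_of_nonneg_left ?_ (hw ij)
    refine ih (grkStep A B (A * Xs * B) ij X0)
      (W - ((A * (X0 - Xs) * B) ij.1 ij.2 /
        (vecNormSq (A ij.1) * vecNormSq (fun b => B b ij.2))) • Matrix.single ij.1 ij.2 1) ?_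
    rw [step_err, rank1_eq]
    generalize (A * (X0 - Xs) * B) ij.1 ij.2 /
      (vecNormSq (A ij.1) * vecNormSq (fun b => B b ij.2)) = c
    rw [Matrix.mul_sub, Matrix.sub_mul, Matrix.mul_smul, Matrix.smul_mul,
      ← hX0]
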